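/- arXiv:2403.12938 — 2 statements merged into one kernel-verified Lean document; each statement's English description precedes it below -/
import Mathlib

section
/- (Picard–Lindelöf for index-1 DAEs.) Let f : ℝ^n × ℝ^m × ℝ^p → ℝ^n and g : ℝ^n × ℝ^m × ℝ^p → ℝ^m be continuously differentiable in a neighborhood of (x₀, y₀, u₀), suppose ∂g/∂y is invertible at (x₀, y₀, u₀) and g(x₀, y₀, u₀) = 0, and let u : ℝ → ℝ^p be continuously differentiable with u(t₀) = u₀. Then there exist Δt > 0 and continuously differentiable functions x : [t₀, t₀+Δt) → ℝ^n and y : [t₀, t₀+Δt) → ℝ^m such that x(t₀) = x₀, y(t₀) = y₀, x'(t) = f(x(t), y(t), u(t)) and g(x(t), y(t), u(t)) = 0 for all t ∈ [t₀, t₀+Δt); moreover the pair (x, y) is unique among continuous pairs taking values in a sufficiently small neighborhood of (x₀, y₀) and satisfying these relations. -/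
open Set Filter Topology in
lemma dae_implicit {X Y U : Type*} [NormedAddCommGroup X] [NormedSpace ℝ X] [CompleteSpace X]
    [NormedAddCommGroup Y] [NormedSpace ℝ Y] [CompleteSpace Y]
    [NormedAddCommGroup U] [NormedSpace ℝ U] [CompleteSpace U]
    (g : X × Y × U → Y) (x₀ : X) (y₀ : Y) (u₀ : U)
    (hg : ContDiffAt ℝ 1 g (x₀, y₀, u₀))
    (hreg : Function.Bijective (fun y : Y => fderiv ℝ g (x₀, y₀, u₀) (0, y, 0)))
    (hcons : g (x₀, y₀, u₀) = 0) :
    ∃ ψ : X × U → Y, ContDiffAt ℝ 1 ψ (x₀, u₀) ∧ ψ (x₀, u₀) = y₀ ∧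
      ∀ᶠ v : X × Y × U in 𝓝 (x₀, y₀, u₀), g v = 0 ↔ ψ (v.1, v.2.2) = v.2.1 := by
  let R : (X × U) × Y →L[ℝ] X × Y × U :=
    ((ContinuousLinearMap.fst ℝ X U).comp (ContinuousLinearMap.fst ℝ (X × U) Y)).prod
      ((ContinuousLinearMap.snd ℝ (X × U) Y).prod
        ((ContinuousLinearMap.snd ℝ X U).comp (ContinuousLinearMap.fst ℝ (X × U) Y)))
  have hR : ∀ v, R v = (v.1.1, v.2, v.1.2) := fun v => rfl
  have hG : ContDiffAt ℝ 1 (g ∘ R) ((x₀, u₀), y₀) :=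
    ContDiffAt.comp _ (by simpa [hR] using hg) R.contDiff.contDiffAt
  have hfd : fderiv ℝ (g ∘ R) ((x₀, u₀), y₀) = (fderiv ℝ g (x₀, y₀, u₀)).comp R := by
    have h1 : HasFDerivAt g (fderiv ℝ g (x₀, y₀, u₀)) (R ((x₀, u₀), y₀)) :=
      (hg.differentiableAt one_ne_zero).hasFDerivAt
    exact (h1.comp _ R.hasFDerivAt).fderiv
  have hinv : (fderiv ℝ (g ∘ R) ((x₀, u₀), y₀) ∘L .inr ℝ (X × U) Y).IsInvertible := by
    rw [hfd]
    set A := ((fderiv ℝ g (x₀, y₀, u₀)).comp R) ∘L .inr ℝ (X × U) Y with hA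
    have hb : Function.Bijective A := hreg
    refine ⟨ContinuousLinearEquiv.ofBijective A (LinearMap.ker_eq_bot.2 hb.1)
      (LinearMap.range_eq_top.2 hb.2), ?_⟩
    ext; rfl
  refine ⟨hG.implicitFunction one_ne_zero hinv,
    hG.contDiffAt_implicitFunction one_ne_zero hinv,
    hG.implicitFunction_apply_self one_ne_zero hinv, ?_⟩
  have h := hG.eventually_apply_eq_iff_implicitFunction one_ne_zero hinv
  have ht : Tendsto (fun v : X × Y × U => ((v.1, v.2.2), v.2.1)) (𝓝 (x₀, y₀, u₀))
      (𝓝 ((x₀, u₀), y₀)) := Continuous.tendsto (by fun_prop) _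
  filter_upwards [ht.eventually h] with v hv
  simpa [hR, hcons] using hv

open Set Filter Topology in
lemma ode_nonauto {X : Type*} [NormedAddCommGroup X] [NormedSpace ℝ X] [CompleteSpace X]
    (F : X × ℝ → X) (x₀ : X) (t₀ : ℝ) (hF : ContDiffAt ℝ 1 F (x₀, t₀)) :
    ∃ x : ℝ → X, x t₀ = x₀ ∧ ∀ᶠ t in 𝓝 t₀, HasDerivAt x (F (x t, t)) t := by
  have hF' : ContDiffAt ℝ 1 (fun z : X × ℝ => (F z, (1 : ℝ))) (x₀, t₀) :=
    hF.prodMk contDiffAt_const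
  obtain ⟨α, h0, ε, hε, hα⟩ :=
    hF'.exists_forall_mem_closedBall_exists_eq_forall_mem_Ioo_hasDerivAt₀ t₀
  have h2 : ∀ t ∈ Ioo (t₀ - ε) (t₀ + ε), HasDerivAt (fun t => (α t).2) 1 t := fun t ht => by
    have := (ContinuousLinearMap.snd ℝ X ℝ).hasFDerivAt.comp_hasDerivAt t (hα t ht)
    exact this
  have ht₀ : t₀ ∈ Ioo (t₀ - ε) (t₀ + ε) := by constructor <;> linarith
  have h3 : ∀ t ∈ Ioo (t₀ - ε) (t₀ + ε), (α t).2 = t := by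
    refine ODE_solution_unique_of_mem_Ioo (K := 0) (v := fun _ _ => (1 : ℝ))
      (s := fun _ => univ) (g := fun t => t)
      (fun t _ => LipschitzWith.const (1 : ℝ) |>.lipschitzOnWith) ht₀
      (fun t ht => ⟨h2 t ht, trivial⟩) (fun t ht => ⟨hasDerivAt_id t, trivial⟩) ?_
    simp [h0]
  refine ⟨fun t => (α t).1, by simp [h0], ?_⟩
  filter_upwards [Ioo_mem_nhds ht₀.1 ht₀.2] with t ht
  have := (ContinuousLinearMap.fst ℝ X ℝ).hasFDerivAt.comp_hasDerivAt t (hα t ht)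
  have e : ((α t).1, t) = α t := Prod.ext rfl (h3 t ht).symm
  rw [e]
  exact this

open Set Filter Topology in
/-- **Picard–Lindelöf theorem for index-1 semi-explicit DAEs.**
Let `f : ℝ^n × ℝ^m × ℝ^p → ℝ^n` and `g : ℝ^n × ℝ^m × ℝ^p → ℝ^m` be continuously
differentiable in a neighborhood of `(x₀, y₀, u₀)`, with `∂g/∂y` invertible at that point and
`g (x₀, y₀, u₀) = 0` (index-1 regularity and consistency), and let `u : ℝ → ℝ^p` be
continuously differentiable with `u t₀ = u₀`. Then there exist `Δt > 0` and continuously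
differentiable `x, y` on `[t₀, t₀ + Δt)` with `x t₀ = x₀`, `y t₀ = y₀`,
`x' t = f (x t, y t, u t)` and `g (x t, y t, u t) = 0` on `[t₀, t₀ + Δt)`; moreover the pair
`(x, y)` is unique among continuous pairs taking values in a sufficiently small neighborhood
of `(x₀, y₀)` and satisfying these relations. -/
theorem picard_lindelof_index1_DAE
    (n m p : ℕ)
    (f : EuclideanSpace ℝ (Fin n) × EuclideanSpace ℝ (Fin m) × EuclideanSpace ℝ (Fin p) →
      EuclideanSpace ℝ (Fin n))
    (g : EuclideanSpace ℝ (Fin n) × EuclideanSpace ℝ (Fin m) × EuclideanSpace ℝ (Fin p) →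
      EuclideanSpace ℝ (Fin m))
    (x₀ : EuclideanSpace ℝ (Fin n)) (y₀ : EuclideanSpace ℝ (Fin m))
    (u₀ : EuclideanSpace ℝ (Fin p)) (u : ℝ → EuclideanSpace ℝ (Fin p)) (t₀ : ℝ)
    (hf : ContDiffAt ℝ 1 f (x₀, y₀, u₀))
    (hg : ContDiffAt ℝ 1 g (x₀, y₀, u₀))
    (hreg : Function.Bijective
      (fun y : EuclideanSpace ℝ (Fin m) => fderiv ℝ g (x₀, y₀, u₀) (0, y, 0)))
    (hcons : g (x₀, y₀, u₀) = 0)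
    (hu : ContDiff ℝ 1 u) (hu0 : u t₀ = u₀) :
    ∃ Δt > (0 : ℝ),
      ∃ x : ℝ → EuclideanSpace ℝ (Fin n), ∃ y : ℝ → EuclideanSpace ℝ (Fin m),
        ContDiffOn ℝ 1 x (Set.Ico t₀ (t₀ + Δt)) ∧
        ContDiffOn ℝ 1 y (Set.Ico t₀ (t₀ + Δt)) ∧
        x t₀ = x₀ ∧ y t₀ = y₀ ∧
        (∀ t ∈ Set.Ico t₀ (t₀ + Δt),
          HasDerivWithinAt x (f (x t, y t, u t)) (Set.Ico t₀ (t₀ + Δt)) t ∧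
          g (x t, y t, u t) = 0) ∧
        ∃ W ∈ nhds (x₀, y₀),
          ∀ x' : ℝ → EuclideanSpace ℝ (Fin n), ∀ y' : ℝ → EuclideanSpace ℝ (Fin m),
            ContinuousOn x' (Set.Ico t₀ (t₀ + Δt)) →
            ContinuousOn y' (Set.Ico t₀ (t₀ + Δt)) →
            (∀ t ∈ Set.Ico t₀ (t₀ + Δt), (x' t, y' t) ∈ W) →
            x' t₀ = x₀ → y' t₀ = y₀ →
            (∀ t ∈ Set.Ico t₀ (t₀ + Δt),
              HasDerivWithinAt x' (f (x' t, y' t, u t)) (Set.Ico t₀ (t₀ + Δt)) t ∧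
              g (x' t, y' t, u t) = 0) →
            ∀ t ∈ Set.Ico t₀ (t₀ + Δt), x' t = x t ∧ y' t = y t := by
  obtain ⟨ψ, hψ, hψ0, hiff⟩ := dae_implicit g x₀ y₀ u₀ hg hreg hcons
  subst hu0
  set h : EuclideanSpace ℝ (Fin n) × ℝ → EuclideanSpace ℝ (Fin m) :=
    fun z => ψ (z.1, u z.2) with hh
  have hhC : ContDiffAt ℝ 1 h (x₀, t₀) := by
    have : ContDiffAt ℝ 1 (fun z : EuclideanSpace ℝ (Fin n) × ℝ => (z.1, u z.2)) (x₀, t₀) :=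
      (contDiff_fst.prodMk (hu.comp contDiff_snd)).contDiffAt
    exact ContDiffAt.comp (x₀, t₀) hψ this
  have hh0 : h (x₀, t₀) = y₀ := hψ0
  set F : EuclideanSpace ℝ (Fin n) × ℝ → EuclideanSpace ℝ (Fin n) :=
    fun z => f (z.1, h z, u z.2) with hFdef
  have hFC : ContDiffAt ℝ 1 F (x₀, t₀) := by
    have h1 : ContDiffAt ℝ 1
        (fun z : EuclideanSpace ℝ (Fin n) × ℝ => (z.1, h z, u z.2)) (x₀, t₀) :=
      contDiffAt_fst.prodMk (hhC.prodMk (hu.comp contDiff_snd).contDiffAt)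
    exact ContDiffAt.comp (x₀, t₀) (by simpa [hh0] using hf) h1
  obtain ⟨x, hx0, hx⟩ := ode_nonauto F x₀ t₀ hFC
  obtain ⟨K, s, hs, hlip⟩ := hFC.exists_lipschitzOnWith
  have hxt : Tendsto (fun t => (x t, t)) (𝓝 t₀) (𝓝 (x₀, t₀)) := by
    have := hx.self_of_nhds.continuousAt.prodMk (continuousAt_id (x := t₀))
    simpa [ContinuousAt, hx0] using this
  have hxyt : Tendsto (fun t => (x t, h (x t, t), u t)) (𝓝 t₀) (𝓝 (x₀, y₀, u t₀)) := by
    have h1 : Tendsto (fun t => h (x t, t)) (𝓝 t₀) (𝓝 y₀) := by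
      have := hhC.continuousAt.tendsto.comp hxt
      rwa [hh0] at this
    exact ((continuous_fst.tendsto _).comp hxt).prodMk_nhds
      (h1.prodMk_nhds (hu.continuous.tendsto t₀))
  -- the uniqueness neighbourhood
  have hev : ∀ᶠ q : (EuclideanSpace ℝ (Fin n) × EuclideanSpace ℝ (Fin m)) × ℝ in
      𝓝 ((x₀, y₀), t₀), (g (q.1.1, q.1.2, u q.2) = 0 ↔ h (q.1.1, q.2) = q.1.2) ∧
        (q.1.1, q.2) ∈ s := by
    have hu' := hu.continuous
    have c1 : Tendsto (fun q : (EuclideanSpace ℝ (Fin n) × EuclideanSpace ℝ (Fin m)) × ℝ =>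
        (q.1.1, q.1.2, u q.2)) (𝓝 ((x₀, y₀), t₀)) (𝓝 (x₀, y₀, u t₀)) :=
      Continuous.tendsto (by fun_prop) ((x₀, y₀), t₀)
    have c2 : Tendsto (fun q : (EuclideanSpace ℝ (Fin n) × EuclideanSpace ℝ (Fin m)) × ℝ =>
        (q.1.1, q.2)) (𝓝 ((x₀, y₀), t₀)) (𝓝 (x₀, t₀)) :=
      Continuous.tendsto (by fun_prop) ((x₀, y₀), t₀)
    filter_upwards [c1.eventually hiff, c2.eventually hs] with q h1 h2
    exact ⟨h1, h2⟩
  rw [nhds_prod_eq, eventually_prod_iff] at hev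
  obtain ⟨pa, hpa, pb, hpb, hW⟩ := hev
  have hall := hx.and <| (hxt.eventually (hhC.eventually (by simp))).and <|
    (hxt.eventually (hFC.eventually (by simp))).and <|
    (hxt.eventually hs).and <| (hxyt.eventually hiff).and hpb
  obtain ⟨δ, hδ, hall⟩ := Metric.eventually_nhds_iff_ball.1 hall
  rw [Real.ball_eq_Ioo] at hall
  have hsub : Ico t₀ (t₀ + δ) ⊆ Ioo (t₀ - δ) (t₀ + δ) := fun t ht => ⟨by linarith [ht.1], ht.2⟩
  have hxC : ContDiffOn ℝ 1 x (Ioo (t₀ - δ) (t₀ + δ)) := by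
    rw [contDiffOn_one_iff_derivWithin isOpen_Ioo.uniqueDiffOn]
    refine ⟨fun t ht => (hall t ht).1.differentiableAt.differentiableWithinAt, ?_⟩
    have hc : ContinuousOn (fun t => F (x t, t)) (Ioo (t₀ - δ) (t₀ + δ)) := fun t ht =>
      (ContinuousAt.comp (f := fun t => (x t, t)) (g := F) (hall t ht).2.2.1.continuousAt
        ((hall t ht).1.continuousAt.prodMk continuousAt_id)).continuousWithinAt
    refine hc.congr fun t ht => ?_
    exact (hall t ht).1.hasDerivWithinAt.derivWithin (isOpen_Ioo.uniqueDiffOn t ht)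
  refine ⟨δ, hδ, x, fun t => h (x t, t), hxC.mono hsub, ?_, hx0, by simp [hx0, hh0], ?_, ?_⟩
  · intro t ht
    have h1 : ContDiffAt ℝ 1 x t := hxC.contDiffAt (isOpen_Ioo.mem_nhds (hsub ht))
    have h2 : ContDiffAt ℝ 1 (fun t => (x t, t)) t := h1.prodMk contDiffAt_id
    exact (ContDiffAt.comp (f := fun t => (x t, t)) (g := h) t (hall t (hsub ht)).2.1 h2).contDiffWithinAt
  · intro t ht
    exact ⟨(hall t (hsub ht)).1.hasDerivWithinAt, (hall t (hsub ht)).2.2.2.2.1.2 rfl⟩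
  · refine ⟨{q | pa q}, hpa, ?_⟩
    intro x' y' hcx hcy hmem hx'0 hy'0 hsol
    have key : ∀ t ∈ Ico t₀ (t₀ + δ), h (x' t, t) = y' t ∧ (x' t, t) ∈ s := fun t ht => by
      have := hW (hmem t ht) (hall t (hsub ht)).2.2.2.2.2
      exact ⟨this.1.1 (hsol t ht).2, this.2⟩
    intro T hT
    have hTs : Icc t₀ T ⊆ Ico t₀ (t₀ + δ) := fun t ht => ⟨ht.1, ht.2.trans_lt hT.2⟩
    have hTs' : Ico t₀ T ⊆ Ico t₀ (t₀ + δ) := Ico_subset_Icc_self.trans hTs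
    have heq : EqOn x' x (Icc t₀ T) := by
      refine ODE_solution_unique_of_mem_Icc_right (K := K) (v := fun t z => F (z, t))
        (s := fun t => {z | (z, t) ∈ s}) ?_ (hcx.mono hTs) ?_ (fun t ht => (key t (hTs' ht)).2)
        (hxC.continuousOn.mono (hTs.trans hsub))
        (fun t ht => (hall t (hsub (hTs' ht))).1.hasDerivWithinAt)
        (fun t ht => (hall t (hsub (hTs' ht))).2.2.2.1) (by rw [hx'0, hx0])
      · intro t ht a ha b hb
        have := hlip ha hb
        simpa [Prod.edist_eq] using this
      · intro t ht
        have h1 := (hsol t (hTs' ht)).1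
        rw [← (key t (hTs' ht)).1] at h1
        refine h1.mono_of_mem_nhdsWithin ?_
        filter_upwards [Ico_mem_nhdsGE (hTs' ht).2] with r hr
        exact ⟨(hTs' ht).1.trans hr.1, hr.2⟩
    have hxT : x' T = x T := heq ⟨hT.1, le_rfl⟩
    refine ⟨hxT, ?_⟩
    rw [← (key T hT).1, hxT]
end

section
/- (Hidden constraint / index reduction of the tank network DAE.) Let φ₁, φ₂, φ₃, φ₄ : ℝ → ℝ be continuous positive area–height profiles, p : ℝ × ℝ → ℝ a pump response function, and α₁, α₂ > 0. Suppose x₁, x₂, x₃, x₄ : I → ℝ are differentiable with x₁(t), x₃(t) ≥ 0, and y₀, y₁, y₂, y₃, y₄ : I → ℝ satisfy, for all t in an interval I: x₁' = (y₁ − y₃)/φ₁(x₁), x₂' = y₂/φ₂(x₂), x₃' = (y₃ − y₄)/φ₃(x₃), x₄' = (y₄ − y₀)/φ₄(x₄), together with the algebraic constraints y₀ = p(x₁, x₄), y₀ = y₁ + y₂, y₃ = α₁√(x₁), y₄ = α₂√(x₃), and x₁ = x₂. Then the algebraic states are uniquely determined by the differential states: for all t ∈ I, y₂(t) = φ₂(x₂(t))·(y₀(t)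 − y₃(t))/(φ₁(x₁(t)) + φ₂(x₂(t))) and y₁(t) = y₀(t) − y₂(t), with y₀(t) = p(x₁(t), x₄(t)), y₃(t) = α₁√(x₁(t)), y₄(t) = α₂√(x₃(t)). -/
/-- **Hidden constraint / index reduction of the tank network DAE.**
Let `φ₁, …, φ₄` be continuous positive area–height profiles, `p` a pump response function,
and `α₁, α₂ > 0`. Suppose on the interval `I = [a, b]` the heights `x₁, …, x₄` (with
`x₁, x₃ ≥ 0`) are differentiable and, together with the flows `y₀, …, y₄`, satisfy
`x₁' = (y₁ − y₃)/φ₁ (x₁)`, `x₂' = y₂/φ₂ (x₂)`, `x₃' = (y₃ − y₄)/φ₃ (x₃)`,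
`x₄' = (y₄ − y₀)/φ₄ (x₄)`, and the algebraic constraints `y₀ = p (x₁, x₄)`,
`y₀ = y₁ + y₂`, `y₃ = α₁ √x₁`, `y₄ = α₂ √x₃`, `x₁ = x₂`. Then the algebraic states are
uniquely determined by the differential states:
`y₂ = φ₂ (x₂) (y₀ − y₃) / (φ₁ (x₁) + φ₂ (x₂))` and `y₁ = y₀ − y₂`, with
`y₀ = p (x₁, x₄)`, `y₃ = α₁ √x₁`, `y₄ = α₂ √x₃`. -/
theorem tank_network_hidden_constraint
    (φ₁ φ₂ φ₃ φ₄ : ℝ → ℝ)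
    (hφ₁c : Continuous φ₁) (hφ₂c : Continuous φ₂)
    (hφ₃c : Continuous φ₃) (hφ₄c : Continuous φ₄)
    (hφ₁ : ∀ s, 0 < φ₁ s) (hφ₂ : ∀ s, 0 < φ₂ s)
    (hφ₃ : ∀ s, 0 < φ₃ s) (hφ₄ : ∀ s, 0 < φ₄ s)
    (p : ℝ × ℝ → ℝ) (α₁ α₂ : ℝ) (hα₁ : 0 < α₁) (hα₂ : 0 < α₂)
    (a b : ℝ) (hab : a < b)
    (x₁ x₂ x₃ x₄ y₀ y₁ y₂ y₃ y₄ : ℝ → ℝ)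
    (hx₁_nonneg : ∀ t ∈ Set.Icc a b, 0 ≤ x₁ t)
    (hx₃_nonneg : ∀ t ∈ Set.Icc a b, 0 ≤ x₃ t)
    (hx₁ : ∀ t ∈ Set.Icc a b,
      HasDerivWithinAt x₁ ((y₁ t - y₃ t) / φ₁ (x₁ t)) (Set.Icc a b) t)
    (hx₂ : ∀ t ∈ Set.Icc a b,
      HasDerivWithinAt x₂ (y₂ t / φ₂ (x₂ t)) (Set.Icc a b) t)
    (hx₃ : ∀ t ∈ Set.Icc a b,
      HasDerivWithinAt x₃ ((y₃ t - y₄ t) / φ₃ (x₃ t)) (Set.Icc a b) t)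
    (hx₄ : ∀ t ∈ Set.Icc a b,
      HasDerivWithinAt x₄ ((y₄ t - y₀ t) / φ₄ (x₄ t)) (Set.Icc a b) t)
    (hpump : ∀ t ∈ Set.Icc a b, y₀ t = p (x₁ t, x₄ t))
    (hcons : ∀ t ∈ Set.Icc a b, y₀ t = y₁ t + y₂ t)
    (hy₃ : ∀ t ∈ Set.Icc a b, y₃ t = α₁ * Real.sqrt (x₁ t))
    (hy₄ : ∀ t ∈ Set.Icc a b, y₄ t = α₂ * Real.sqrt (x₃ t))
    (hheads : ∀ t ∈ Set.Icc a b, x₁ t = x₂ t) :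
    ∀ t ∈ Set.Icc a b,
      y₂ t = φ₂ (x₂ t) * (y₀ t - y₃ t) / (φ₁ (x₁ t) + φ₂ (x₂ t)) ∧
      y₁ t = y₀ t - y₂ t ∧
      y₀ t = p (x₁ t, x₄ t) ∧
      y₃ t = α₁ * Real.sqrt (x₁ t) ∧
      y₄ t = α₂ * Real.sqrt (x₃ t) := by
  intro t ht
  have hu : UniqueDiffWithinAt ℝ (Set.Icc a b) t := uniqueDiffOn_Icc hab t ht
  have h2 : HasDerivWithinAt x₁ (y₂ t / φ₂ (x₂ t)) (Set.Icc a b) t :=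
    (hx₂ t ht).congr hheads (hheads t ht)
  have he : (y₁ t - y₃ t) / φ₁ (x₁ t) = y₂ t / φ₂ (x₂ t) :=
    hu.eq_deriv _ (hx₁ t ht) h2
  have p1 := hφ₁ (x₁ t)
  have p2 := hφ₂ (x₂ t)
  have hc := hcons t ht
  refine ⟨?_, by linarith, hpump t ht, hy₃ t ht, hy₄ t ht⟩
  rw [div_eq_div_iff p1.ne' p2.ne'] at he
  rw [eq_div_iff (by positivity), hc]
  linear_combination -he
end
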